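/- Under hypotheses (H1)–(H4), with d = |K ∩ H⁺|^{1/n} − ((n/(n+1))ⁿ)^{1/n} and h = c^{n−1} − g^{n−1} (pointwise, with g and c extended by 0 outside [a,b] and [a',b'] respectively), one has ∫_ℝ |h(x)| dx ≤ 16·n^{3/2}·√d. -/

import Mathlib

open MeasureTheory Set
open scoped ENNReal Pointwise

/-- One-dimensional Brunn-Minkowski, compact sets. -/
theorem bm1_compact (A B : Set ℝ) (hA : IsCompact A) (hB : IsCompact B)
    (hAn : A.Nonempty) (hBn : B.Nonempty) : volume A + volume B ≤ volume (A + B) := by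
  obtain ⟨a, haA, ha⟩ := hA.exists_isGreatest hAn
  obtain ⟨b, hbB, hb⟩ := hB.exists_isLeast hBn
  have h1 : volume A = volume ((fun x => x + b) '' A) := by
    rw [image_add_right]; simp
  have h2 : volume B = volume ((fun x => a + x) '' B) := by
    rw [image_add_left]; simp
  have hc2 : IsCompact ((fun x => a + x) '' B) := hB.image (by fun_prop)
  have hd : AEDisjoint volume ((fun x => x + b) '' A) ((fun x => a + x) '' B) := by
    refine measure_mono_null (t := {a + b}) ?_ (by simp)
    rintro z ⟨⟨x, hx, rfl⟩, ⟨y, hy, hxy⟩⟩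
    have := ha hx
    have := hb hy
    simp only at hxy
    simp only [mem_singleton_iff]
    linarith
  rw [h1, h2, ← measure_union₀ hc2.measurableSet.nullMeasurableSet hd]
  apply measure_mono
  rintro z (⟨x, hx, rfl⟩ | ⟨y, hy, rfl⟩)
  · exact add_mem_add hx hbB
  · exact add_mem_add haA hy

theorem bm1 (A B C : Set ℝ) (hA : MeasurableSet A) (hB : MeasurableSet B)
    (hAn : A.Nonempty) (hBn : B.Nonempty) {p q : ℝ} (hp : 0 < p) (hq : 0 < q)
    (hC : ∀ x ∈ A, ∀ y ∈ B, p * x + q * y ∈ C) :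
    ENNReal.ofReal p * volume A + ENNReal.ofReal q * volume B ≤ volume C := by
  have key : ∀ k1 ⊆ A, IsCompact k1 → ∀ k2 ⊆ B, IsCompact k2 →
      ENNReal.ofReal p * volume k1 + ENNReal.ofReal q * volume k2 ≤ volume C := by
    intro k1 h1 hk1 k2 h2 hk2
    obtain ⟨x, hx⟩ := hAn
    obtain ⟨y, hy⟩ := hBn
    have := bm1_compact (p • (insert x k1)) (q • (insert y k2)) ((hk1.insert x).smul p)
      ((hk2.insert y).smul q) ((insert_nonempty _ _).smul_set) ((insert_nonempty _ _).smul_set)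
    rw [Measure.addHaar_smul, Measure.addHaar_smul] at this
    simp only [Module.finrank_self, pow_one, abs_of_pos hp, abs_of_pos hq] at this
    calc _ ≤ ENNReal.ofReal p * volume (insert x k1) + ENNReal.ofReal q * volume (insert y k2) := by
          gcongr <;> exact subset_insert _ _
      _ ≤ _ := this
      _ ≤ _ := by
        apply measure_mono
        rintro z ⟨u, hu, v, hv, rfl⟩
        obtain ⟨u, hu, rfl⟩ := hu
        obtain ⟨v, hv, rfl⟩ := hv
        exact hC u (insert_subset hx h1 hu) v (insert_subset hy h2 hv)
  rw [hA.measure_eq_iSup_isCompact, hB.measure_eq_iSup_isCompact]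
  simp only [ENNReal.mul_iSup]
  refine ENNReal.biSup_add_biSup_le' (p := fun k => k ⊆ A) (q := fun k => k ⊆ B) ⟨∅, empty_subset _⟩ ⟨∅, empty_subset _⟩ ?_
  intro k1 h1 k2 h2
  by_cases hk1 : IsCompact k1 <;> by_cases hk2 : IsCompact k2 <;> simp only [hk1, hk2, iSup_true, iSup_false]
  · exact key k1 h1 hk1 k2 h2 hk2
  · simpa using key k1 h1 hk1 ∅ (empty_subset _) isCompact_empty
  · simpa using key ∅ (empty_subset _) isCompact_empty k2 h2 hk2
  · simp

theorem layer {f : ℝ → ℝ≥0∞} (hf : Measurable f) (h1 : ∀ x, f x ≤ 1) :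
    ∫⁻ x, f x = ∫⁻ t in Ioi (0:ℝ), volume {x | ENNReal.ofReal t < f x} := by
  have hfin : ∀ x, f x ≠ ⊤ := fun x => ne_top_of_le_ne_top ENNReal.one_ne_top (h1 x)
  have := lintegral_eq_lintegral_meas_lt (volume : Measure ℝ) (f := fun x => (f x).toReal)
    (Filter.Eventually.of_forall fun x => ENNReal.toReal_nonneg) hf.ennreal_toReal.aemeasurable
  simp only [ENNReal.ofReal_toReal (hfin _)] at this
  rw [this]
  apply setLIntegral_congr_fun measurableSet_Ioi
  intro t ht
  simp only
  congr 1
  ext x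
  simp only [mem_ofPred_eq]
  exact (ENNReal.ofReal_lt_iff_lt_toReal (le_of_lt ht) (hfin x)).symm

theorem pl1_norm {f g h : ℝ → ℝ≥0∞} (hf : Measurable f) (hg : Measurable g) (hh : Measurable h)
    {p q : ℝ} (hp : 0 < p) (hq : 0 < q) (hpq : p + q = 1)
    (hfs : ⨆ x, f x = 1) (hgs : ⨆ x, g x = 1)
    (H : ∀ x y, f x ^ p * g y ^ q ≤ h (p * x + q * y)) :
    ENNReal.ofReal p * (∫⁻ x, f x) + ENNReal.ofReal q * (∫⁻ x, g x) ≤ ∫⁻ x, h x := by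
  have hf1 : ∀ x, f x ≤ 1 := fun x => hfs ▸ le_iSup f x
  have hg1 : ∀ x, g x ≤ 1 := fun x => hgs ▸ le_iSup g x
  have hm : Measurable fun x => min (h x) 1 := hh.min measurable_const
  calc _ = ∫⁻ t in Ioi (0:ℝ), (ENNReal.ofReal p * volume {x | ENNReal.ofReal t < f x} +
          ENNReal.ofReal q * volume {x | ENNReal.ofReal t < g x}) := by
        have m1 : Measurable fun t : ℝ => volume {x | ENNReal.ofReal t < f x} :=
          Antitone.measurable (fun s t hst => measure_mono fun x hx =>
            lt_of_le_of_lt (ENNReal.ofReal_le_ofReal hst) hx)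
        have m2 : Measurable fun t : ℝ => volume {x | ENNReal.ofReal t < g x} :=
          Antitone.measurable (fun s t hst => measure_mono fun x hx =>
            lt_of_le_of_lt (ENNReal.ofReal_le_ofReal hst) hx)
        rw [lintegral_add_left (m1.const_mul _), lintegral_const_mul _ m1, lintegral_const_mul _ m2,
          layer hf hf1, layer hg hg1]
    _ ≤ ∫⁻ t in Ioi (0:ℝ), volume {x | ENNReal.ofReal t < min (h x) 1} := by
        apply setLIntegral_mono' measurableSet_Ioi
        intro t ht
        by_cases ht1 : t < 1
        · have ht1' : ENNReal.ofReal t < 1 := by simpa using ht1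
          have htt : ENNReal.ofReal t ^ p * ENNReal.ofReal t ^ q = ENNReal.ofReal t := by
            rw [← ENNReal.rpow_add _ _ (by simpa using ht) ENNReal.ofReal_ne_top, hpq,
              ENNReal.rpow_one]
          apply bm1 _ _ _ (measurableSet_lt measurable_const hf) (measurableSet_lt measurable_const hg)
            _ _ hp hq
          · intro x hx y hy
            simp only [mem_ofPred_eq, lt_min_iff] at *
            refine ⟨lt_of_lt_of_le ?_ (H x y), ht1'⟩
            rw [← htt]
            exact ENNReal.mul_lt_mul (ENNReal.rpow_lt_rpow hx hp) (ENNReal.rpow_lt_rpow hy hq)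
          · rw [← hfs] at ht1'
            exact lt_iSup_iff.1 ht1'
          · rw [← hgs] at ht1'
            exact lt_iSup_iff.1 ht1'
        · have ht1' : 1 ≤ ENNReal.ofReal t := by simpa using ht1
          have e1 : {x | ENNReal.ofReal t < f x} = ∅ := by
            ext x; simpa using (hf1 x).trans ht1'
          have e2 : {x | ENNReal.ofReal t < g x} = ∅ := by
            ext x; simpa using (hg1 x).trans ht1'
          simp [e1, e2]
    _ = ∫⁻ x, min (h x) 1 := (layer hm (fun x => min_le_right _ _)).symm
    _ ≤ _ := lintegral_mono fun x => min_le_left _ _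

theorem amgm_ennreal (x y : ℝ≥0∞) {p q : ℝ} (hp : 0 < p) (hq : 0 < q) (hpq : p + q = 1) :
    x ^ p * y ^ q ≤ ENNReal.ofReal p * x + ENNReal.ofReal q * y := by
  by_cases hx : x = ⊤
  · subst hx; simp [ENNReal.mul_top, hp]
  by_cases hy : y = ⊤
  · subst hy; simp [ENNReal.mul_top, hq]
  lift x to NNReal using hx
  lift y to NNReal using hy
  have := NNReal.geom_mean_le_arith_mean2_weighted p.toNNReal q.toNNReal x y
    (by rw [← Real.toNNReal_add hp.le hq.le, hpq]; simp)
  rw [Real.coe_toNNReal _ hp.le, Real.coe_toNNReal _ hq.le] at this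
  rw [← ENNReal.coe_rpow_of_nonneg _ hp.le, ← ENNReal.coe_rpow_of_nonneg _ hq.le, ENNReal.ofReal, ENNReal.ofReal]
  exact_mod_cast this

theorem pl1_bdd {f g h : ℝ → ℝ≥0∞} (hf : Measurable f) (hg : Measurable g) (hh : Measurable h)
    {p q : ℝ} (hp : 0 < p) (hq : 0 < q) (hpq : p + q = 1)
    (hfs : ⨆ x, f x ≠ ⊤) (hgs : ⨆ x, g x ≠ ⊤)
    (H : ∀ x y, f x ^ p * g y ^ q ≤ h (p * x + q * y)) :
    (∫⁻ x, f x) ^ p * (∫⁻ x, g x) ^ q ≤ ∫⁻ x, h x := by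
  set F := ⨆ x, f x with hF
  set G := ⨆ x, g x with hG
  by_cases hF0 : F = 0
  · have : ∀ x, f x = 0 := by simpa [hF] using hF0
    simp [this, hp]
  by_cases hG0 : G = 0
  · have : ∀ x, g x = 0 := by simpa [hG] using hG0
    simp [this, hq]
  set c := F ^ p * G ^ q with hc
  have hc0 : c ≠ 0 := by
    simp [hc, hF0, hG0, hfs, hgs]
  have hct : c ≠ ⊤ := by
    apply ENNReal.mul_ne_top <;> apply ENNReal.rpow_ne_top_of_nonneg <;> first | assumption | linarith
  have e := pl1_norm (f := fun x => F⁻¹ * f x) (g := fun x => G⁻¹ * g x) (h := fun x => c⁻¹ * h x)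
    (hf.const_mul _) (hg.const_mul _) (hh.const_mul _) hp hq hpq
    (by rw [← ENNReal.mul_iSup]; exact ENNReal.inv_mul_cancel hF0 hfs)
    (by rw [← ENNReal.mul_iSup]; exact ENNReal.inv_mul_cancel hG0 hgs)
    (by
      intro x y
      rw [ENNReal.mul_rpow_of_nonneg _ _ hp.le, ENNReal.mul_rpow_of_nonneg _ _ hq.le, hc,
        ENNReal.mul_inv (Or.inr (ENNReal.rpow_ne_top_of_nonneg hq.le hgs)) 
          (Or.inl (ENNReal.rpow_ne_top_of_nonneg hp.le hfs)), ENNReal.inv_rpow, ENNReal.inv_rpow,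
          mul_mul_mul_comm]
      gcongr
      exact H x y)
  rw [lintegral_const_mul _ hf, lintegral_const_mul _ hg, lintegral_const_mul _ hh] at e
  have e2 := (amgm_ennreal _ _ hp hq hpq).trans e
  rw [ENNReal.mul_rpow_of_nonneg _ _ hp.le, ENNReal.mul_rpow_of_nonneg _ _ hq.le,
        mul_mul_mul_comm, ENNReal.inv_rpow, ENNReal.inv_rpow, ← ENNReal.mul_inv (Or.inr (ENNReal.rpow_ne_top_of_nonneg hq.le hgs)) 
          (Or.inl (ENNReal.rpow_ne_top_of_nonneg hp.le hfs))] at e2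
  calc _ = c * (c⁻¹ * ((∫⁻ x, f x) ^ p * (∫⁻ x, g x) ^ q)) := by
        rw [← mul_assoc, ENNReal.mul_inv_cancel hc0 hct, one_mul]
    _ ≤ c * (c⁻¹ * ∫⁻ x, h x) := by gcongr
    _ = _ := by rw [← mul_assoc, ENNReal.mul_inv_cancel hc0 hct, one_mul]

theorem trunc_tendsto {f : ℝ → ℝ≥0∞} (hf : Measurable f) :
    Filter.Tendsto (fun N : ℕ => ∫⁻ x, min (f x) N) Filter.atTop (nhds (∫⁻ x, f x)) := by
  apply lintegral_tendsto_of_tendsto_of_monotone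
  · intro N; exact (hf.min measurable_const).aemeasurable
  · refine Filter.Eventually.of_forall fun x => fun a b hab => ?_
    exact min_le_min le_rfl (by exact_mod_cast hab)
  · refine Filter.Eventually.of_forall fun x => ?_
    have := (tendsto_const_nhds (x := f x)).min ENNReal.tendsto_nat_nhds_top
    simpa using this

theorem pl1 {f g h : ℝ → ℝ≥0∞} (hf : Measurable f) (hg : Measurable g) (hh : Measurable h)
    {p q : ℝ} (hp : 0 < p) (hq : 0 < q) (hpq : p + q = 1)
    (H : ∀ x y, f x ^ p * g y ^ q ≤ h (p * x + q * y)) :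
    (∫⁻ x, f x) ^ p * (∫⁻ x, g x) ^ q ≤ ∫⁻ x, h x := by
  by_cases hF0 : ∫⁻ x, f x = 0
  · simp [hF0, hp]
  by_cases hG0 : ∫⁻ x, g x = 0
  · simp [hG0, hq]
  have t1 := (trunc_tendsto hf).ennrpow_const p
  have t2 := (trunc_tendsto hg).ennrpow_const q
  have t := ENNReal.Tendsto.mul t1 (Or.inl (by simp [hF0, hp, not_lt.2 hp.le])) t2 (Or.inl (by simp [hG0, hq, not_lt.2 hq.le]))
  refine le_of_tendsto' t fun N => ?_
  refine pl1_bdd (hf.min measurable_const) (hg.min measurable_const) hh hp hq hpq ?_ ?_ ?_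
  · exact ne_top_of_le_ne_top (ENNReal.natCast_ne_top N) (iSup_le fun x => min_le_right _ _)
  · exact ne_top_of_le_ne_top (ENNReal.natCast_ne_top N) (iSup_le fun x => min_le_right _ _)
  · intro x y
    refine le_trans ?_ (H x y)
    gcongr <;> exact min_le_left _ _

/-- Prekopa-Leindler property of a measured real vector space. -/
def PLprop (E : Type) [AddCommGroup E] [Module ℝ E] [MeasureSpace E] : Prop :=
  ∀ f g h : E → ℝ≥0∞, Measurable f → Measurable g → Measurable h → ∀ p q : ℝ, 0 < p → 0 < q →
    p + q = 1 → (∀ x y, f x ^ p * g y ^ q ≤ h (p • x + q • y)) →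
    (∫⁻ x, f x) ^ p * (∫⁻ x, g x) ^ q ≤ ∫⁻ x, h x

theorem PLprop_real : PLprop ℝ := fun _ _ _ hf hg hh _ _ hp hq hpq H =>
  pl1 hf hg hh hp hq hpq H

theorem PLprop_prod {E F : Type} [AddCommGroup E] [Module ℝ E] [MeasureSpace E]
    [AddCommGroup F] [Module ℝ F] [MeasureSpace F] [SFinite (volume : Measure E)]
    [SFinite (volume : Measure F)]
    (hE : PLprop E) (hF : PLprop F) : PLprop (E × F) := by
  intro f g h hf hg hh p q hp hq hpq H
  rw [Measure.volume_eq_prod, lintegral_prod _ hf.aemeasurable, lintegral_prod _ hg.aemeasurable,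
    lintegral_prod _ hh.aemeasurable]
  refine hE _ _ _ hf.lintegral_prod_right' hg.lintegral_prod_right' hh.lintegral_prod_right'
    p q hp hq hpq ?_
  intro x y
  refine hF _ _ _ (hf.comp measurable_prodMk_left) (hg.comp measurable_prodMk_left)
    (hh.comp measurable_prodMk_left) p q hp hq hpq ?_
  intro u v
  exact H (x, u) (y, v)

theorem PLprop_equiv {E F : Type} [AddCommGroup E] [Module ℝ E] [MeasureSpace E]
    [AddCommGroup F] [Module ℝ F] [MeasureSpace F] (e : E → F)
    (hadd : ∀ (p q : ℝ) x y, e (p • x + q • y) = p • e x + q • e y)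
    (he : MeasurePreserving e volume volume) 
    (hE : PLprop E) : PLprop F := by
  intro f g h hf hg hh p q hp hq hpq H
  rw [← he.lintegral_comp hf, ← he.lintegral_comp hg, ← he.lintegral_comp hh]
  refine hE _ _ _ (hf.comp he.measurable) (hg.comp he.measurable) (hh.comp he.measurable) p q hp hq hpq ?_
  intro x y
  simpa [hadd] using H (e x) (e y)

theorem PLprop_pi : ∀ m : ℕ, PLprop (Fin m → ℝ)
  | 0 => by
    intro f g h hf hg hh p q hp hq hpq H
    have e : (volume : Measure (Fin 0 → ℝ)) = Measure.dirac default := by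
      rw [volume_pi]; exact Measure.pi_of_empty _ _
    rw [e, lintegral_dirac, lintegral_dirac, lintegral_dirac]
    convert H default default
  | m + 1 => by
    have := PLprop_prod PLprop_real (PLprop_pi m)
    refine PLprop_equiv (MeasurableEquiv.piFinSuccAbove (fun _ : Fin (m+1) => ℝ) 0).symm ?_ ?_ this
    · intro p q x y
      ext i
      refine Fin.cases ?_ (fun j => ?_) i <;> simp
    · exact (volume_preserving_piFinSuccAbove (fun _ : Fin (m+1) => ℝ) 0).symm

theorem PLprop_euclidean (m : ℕ) : PLprop (EuclideanSpace ℝ (Fin m)) := by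
  refine PLprop_equiv (WithLp.toLp 2) ?_ (PiLp.volume_preserving_toLp (Fin m)) (PLprop_pi m)
  intro p q x y
  simp


theorem PL_set {E : Type} [AddCommGroup E] [Module ℝ E] [MeasureSpace E] (hE : PLprop E)
    (A B C : Set E) (hA : MeasurableSet A) (hB : MeasurableSet B) (hC : MeasurableSet C)
    (hA1 : volume A = 1) (hB1 : volume B = 1) {p q : ℝ} (hp : 0 < p) (hq : 0 < q) (hpq : p + q = 1)
    (H : ∀ x ∈ A, ∀ y ∈ B, p • x + q • y ∈ C) : 1 ≤ volume C := by
  have := hE (A.indicator 1) (B.indicator 1) (C.indicator 1) (measurable_one.indicator hA)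
    (measurable_one.indicator hB) (measurable_one.indicator hC) p q hp hq hpq (by
      intro x y
      by_cases hx : x ∈ A
      · by_cases hy : y ∈ B
        · simp [hx, hy, H x hx y hy]
        · simp [hy, hq]
      · simp [hx, hp])
  simpa [lintegral_indicator_one, hA, hB, hC, hA1, hB1] using this

theorem BM (m : ℕ) (A B C : Set (EuclideanSpace ℝ (Fin m)))
    (hA : MeasurableSet A) (hB : MeasurableSet B) (hC : MeasurableSet C)
    (α β : ℝ) (hα : 0 < α) (hβ : 0 < β)
    (hA1 : volume A = ENNReal.ofReal (α ^ m)) (hB1 : volume B = ENNReal.ofReal (β ^ m))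
    {p q : ℝ} (hp : 0 < p) (hq : 0 < q)
    (H : ∀ x ∈ A, ∀ y ∈ B, p • x + q • y ∈ C) :
    ENNReal.ofReal ((p * α + q * β) ^ m) ≤ volume C := by
  set N := p * α + q * β with hN
  have hN0 : 0 < N := by positivity
  have sc : ∀ (S : Set (EuclideanSpace ℝ (Fin m))) (γ : ℝ), 0 < γ → volume (γ⁻¹ • S) =
      ENNReal.ofReal ((γ ^ m)⁻¹) * volume S := by
    intro S γ hγ
    rw [Measure.addHaar_smul, finrank_euclideanSpace_fin, abs_of_nonneg (by positivity), inv_pow]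
  have h1 : ∀ γ : ℝ, 0 < γ → ENNReal.ofReal ((γ ^ m)⁻¹) * ENNReal.ofReal (γ ^ m) = 1 := by
    intro γ hγ
    rw [← ENNReal.ofReal_mul (by positivity), inv_mul_cancel₀ (by positivity), ENNReal.ofReal_one]
  have := PL_set (PLprop_euclidean m) (α⁻¹ • A) (β⁻¹ • B) (N⁻¹ • C) (hA.const_smul₀ _)
    (hB.const_smul₀ _) (hC.const_smul₀ _) (by rw [sc _ _ hα, hA1, h1 _ hα])
    (by rw [sc _ _ hβ, hB1, h1 _ hβ]) (p := p * α / N) (q := q * β / N) (by positivity)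
    (by positivity) (by rw [← add_div, ← hN, div_self hN0.ne']) (by
      rintro _ ⟨x, hx, rfl⟩ _ ⟨y, hy, rfl⟩
      refine ⟨_, H x hx y hy, ?_⟩
      simp only [smul_add, smul_smul]
      congr 2 <;> field_simp)
  rw [sc _ _ hN0] at this
  calc ENNReal.ofReal (N ^ m) = ENNReal.ofReal (N ^ m) * 1 := by rw [mul_one]
    _ ≤ ENNReal.ofReal (N ^ m) * (ENNReal.ofReal ((N ^ m)⁻¹) * volume C) := by gcongr
    _ = volume C := by rw [← mul_assoc, mul_comm (ENNReal.ofReal (N ^ m)), h1 _ hN0, one_mul]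

/-- Properties of the (normalized) section profile. -/
structure Prof (m : ℕ) (g : ℝ → ℝ) (R : ℝ) : Prop where
  hm : 1 ≤ m
  meas : Measurable g
  nonneg : ∀ x, 0 ≤ g x
  le_one : ∀ x, g x ≤ 1
  top : ∃ x, g x = 1
  supp : ∀ x, R < |x| → g x = 0
  conc : ∀ x y, 0 < g x → 0 < g y → ∀ p q : ℝ, 0 < p → 0 < q → p + q = 1 →
    p * g x + q * g y ≤ g (p * x + q * y)
  mass : ∫ x, g x ^ m = 1
  bary : ∫ x, x * g x ^ m = 0

theorem intg {φ : ℝ → ℝ} (hm : Measurable φ) (C R : ℝ) (hC : ∀ x, |φ x| ≤ C)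
    (hR : ∀ x, R < |x| → φ x = 0) : Integrable φ := by
  have h1 : IntegrableOn φ (Icc (-R) R) :=
    Measure.integrableOn_of_bounded (M := C) (by simp) hm.aestronglyMeasurable
      (Filter.Eventually.of_forall hC)
  rw [integrableOn_iff_integrable_of_support_subset] at h1
  · exact h1
  · intro x hx
    by_contra hx2
    apply hx
    apply hR
    by_contra h3
    exact hx2 (abs_le.1 (not_lt.1 h3))

theorem bern (u v : ℝ) (hu : 0 ≤ u) (hv : 0 ≤ v) (m : ℕ) :
    v ^ (m + 1) + (m + 1) * u * v ^ m ≤ (u + v) ^ (m + 1) := by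
  induction m with
  | zero => simp; linarith
  | succ k ih =>
    rw [pow_succ (u + v)]
    have : 0 ≤ (k + 1) * u * v ^ k := by positivity
    have h0 : 0 ≤ (k + 1) * u ^ 2 * v ^ k := by positivity
    have := mul_le_mul_of_nonneg_right ih (add_nonneg hu hv)
    push_cast
    refine le_trans ?_ this
    ring_nf at *
    nlinarith

namespace Prof
variable {m : ℕ} {g : ℝ → ℝ} {R : ℝ}

theorem intg_pow (P : Prof m g R) (k : ℕ) (hk : k ≠ 0) : Integrable fun x => g x ^ k := by
  refine intg (P.meas.pow_const k) 1 R ?_ ?_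
  · intro x
    rw [abs_of_nonneg (pow_nonneg (P.nonneg x) k)]
    exact pow_le_one₀ (P.nonneg x) (P.le_one x)
  · intro x hx
    simp [P.supp x hx, hk]

theorem intg_mul_pow (P : Prof m g R) (k : ℕ) (hk : k ≠ 0) : Integrable fun x => x * g x ^ k := by
  refine intg (measurable_id.mul (P.meas.pow_const k)) R R ?_ ?_
  · intro x
    rw [abs_mul, abs_of_nonneg (pow_nonneg (P.nonneg x) k)]
    by_cases hx : R < |x|
    · simp [P.supp x hx, hk]
      obtain ⟨y, hy⟩ := P.top
      by_contra h
      have := P.supp y (lt_of_lt_of_le (not_le.1 h) (abs_nonneg y))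
      simp [this] at hy
    · have := pow_le_one₀ (n := k) (P.nonneg x) (P.le_one x)
      have h0 := pow_nonneg (P.nonneg x) k
      nlinarith [abs_nonneg x]
  · intro x hx
    simp [P.supp x hx, hk]

theorem J_bound (P : Prof m g R) : ((m : ℝ) + 1) ≤ ((m : ℝ) + 2) * ∫ x, g x ^ (m + 1) := by
  obtain ⟨x0, hx0⟩ := P.top
  set J := ∫ x, g x ^ (m + 1) with hJ
  have hm0 : m ≠ 0 := by have := P.hm; omega
  have hJ0 : 0 ≤ J := integral_nonneg fun x => pow_nonneg (P.nonneg x) _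
  have key : ∀ l : ℝ, 0 < l → l < 1 → ((m : ℝ) + 1) * l ^ (m + 1) ≤ (m + 2) * J := by
    intro l hl hl1
    have e1 : ∫ x, g (l * x + (1 - l) * x0) ^ (m + 1) = l⁻¹ * J := by
      have := Measure.integral_comp_mul_left (fun y => g (y + (1 - l) * x0) ^ (m + 1)) l
      rw [this, integral_add_right_eq_self (fun y => g y ^ (m + 1)), abs_of_pos (by positivity),
        smul_eq_mul]
    have hi : Integrable fun x => g (l * x + (1 - l) * x0) ^ (m + 1) := by
      have h1 := (P.intg_pow (m + 1) (by omega)).comp_add_right ((1 - l) * x0)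
      exact h1.comp_mul_left' hl.ne'
    have hpt : ∀ x, l ^ (m + 1) * g x ^ (m + 1) + ((m + 1) * (1 - l) * l ^ m) * g x ^ m ≤
        g (l * x + (1 - l) * x0) ^ (m + 1) := by
      intro x
      by_cases hx : g x = 0
      · simp only [hx, ne_eq, hm0, not_false_eq_true, zero_pow, Nat.add_eq_zero_iff, one_ne_zero, and_false]
        simpa using pow_nonneg (P.nonneg _) _
      have hx' : 0 < g x := lt_of_le_of_ne (P.nonneg x) (Ne.symm hx)
      have := P.conc x x0 hx' (by rw [hx0]; exact one_pos) l (1 - l) hl (by linarith) (by ring)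
      rw [hx0, mul_one] at this
      have h2 := bern (1 - l) (l * g x) (by linarith) (by positivity) m
      rw [mul_pow, mul_pow] at h2
      have h3 := pow_le_pow_left₀ (by nlinarith) this (m + 1)
      rw [add_comm (1 - l)] at h2
      nlinarith
    have h1 := integral_mono (((P.intg_pow (m + 1) (by omega)).const_mul _).add
      ((P.intg_pow m hm0).const_mul _)) hi hpt
    simp only [Pi.add_apply] at h1
    rw [integral_add ((P.intg_pow (m + 1) (by omega)).const_mul _)
      ((P.intg_pow m hm0).const_mul _), integral_const_mul, integral_const_mul, P.mass, e1, ← hJ,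
      mul_one] at h1
    have h2 : l * (l ^ (m + 1) * J + (m + 1) * (1 - l) * l ^ m) ≤ J := by
      have := mul_le_mul_of_nonneg_left h1 hl.le
      rwa [mul_inv_cancel_left₀ hl.ne'] at this
    have h3 := one_add_mul_le_pow (a := l - 1) (by linarith) (m + 2)
    have h4 : (1 - l) * (((m : ℝ) + 1) * l ^ (m + 1)) ≤ (1 - l) * ((m + 2) * J) := by
      have e : (1 + (l - 1)) ^ (m + 2) = l * l ^ (m + 1) := by ring
      rw [e] at h3
      push_cast at h3
      have e2 : l ^ (m + 1) = l * l ^ m := by ring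
      have h5 := mul_le_mul_of_nonneg_right h3 hJ0
      rw [e2] at *
      nlinarith
    exact le_of_mul_le_mul_left h4 (by linarith)
  have ht : Filter.Tendsto (fun l : ℝ => ((m : ℝ) + 1) * l ^ (m + 1)) (nhdsWithin 1 (Iio 1))
      (nhds (((m : ℝ) + 1) * 1 ^ (m + 1))) :=
    (Continuous.tendsto (by fun_prop) 1).mono_left nhdsWithin_le_nhds
  rw [one_pow, mul_one] at ht
  refine le_of_tendsto ht ?_
  filter_upwards [Ioo_mem_nhdsLT (show (0 : ℝ) < 1 by norm_num)] with l hl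
  exact key l hl.1 hl.2

theorem not_zero (P : Prof m g R) (h : ∀ᵐ x, x * g x ^ m = 0) : False := by
  have : ∀ᵐ x, g x ^ m = 0 := by
    have h0 : ∀ᵐ x : ℝ, x ≠ 0 := by
      simp [ae_iff]
    filter_upwards [h, h0] with x hx hx0
    simpa [hx0] using hx
  have h1 := integral_congr_ae this
  rw [P.mass] at h1
  simp at h1

theorem ex_pos (P : Prof m g R) : ∃ x, 0 < x ∧ 0 < g x := by
  by_contra! hc
  have hm0 : m ≠ 0 := by have := P.hm; omega
  have h1 : 0 ≤ᵐ[volume] fun x => -(x * g x ^ m) := by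
    refine Filter.Eventually.of_forall fun x => ?_
    simp only [Pi.zero_apply]
    by_cases hx : 0 < x
    · have : g x = 0 := le_antisymm (hc x hx) (P.nonneg x)
      simp [this, hm0]
    · have := pow_nonneg (P.nonneg x) m
      nlinarith
  have h2 := (integral_eq_zero_iff_of_nonneg_ae h1 (P.intg_mul_pow m hm0).neg).1 (by
    rw [integral_neg, P.bary, neg_zero])
  apply P.not_zero
  filter_upwards [h2] with x hx
  simpa using hx

theorem ex_neg (P : Prof m g R) : ∃ x, x < 0 ∧ 0 < g x := by
  by_contra! hc
  have hm0 : m ≠ 0 := by have := P.hm; omega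
  have h1 : 0 ≤ᵐ[volume] fun x => (x * g x ^ m) := by
    refine Filter.Eventually.of_forall fun x => ?_
    simp only [Pi.zero_apply]
    by_cases hx : x < 0
    · have : g x = 0 := le_antisymm (hc x hx) (P.nonneg x)
      simp [this, hm0]
    · have := pow_nonneg (P.nonneg x) m
      have := not_lt.1 hx
      positivity
  have h2 := (integral_eq_zero_iff_of_nonneg_ae h1 (P.intg_mul_pow m hm0)).1 P.bary
  exact P.not_zero h2

/-- three-point concavity -/
theorem conc3 (P : Prof m g R) {x y z : ℝ} (hxy : x < y) (hyz : y < z) (hx : 0 < g x)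
    (hz : 0 < g z) : (z - y) * g x + (y - x) * g z ≤ (z - x) * g y := by
  have hzx : 0 < z - x := by linarith
  have := P.conc x z hx hz ((z - y) / (z - x)) ((y - x) / (z - x)) (div_pos (by linarith) hzx)
    (div_pos (by linarith) hzx) (by field_simp; ring)
  have e : (z - y) / (z - x) * x + (y - x) / (z - x) * z = y := by field_simp; ring
  rw [e] at this
  have h2 := mul_le_mul_of_nonneg_left this hzx.le
  have e2 : (z - x) * ((z - y) / (z - x) * g x + (y - x) / (z - x) * g z) =
    (z - y) * g x + (y - x) * g z := by field_simp
  linarith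

theorem pos_mid (P : Prof m g R) {x y z : ℝ} (hxy : x < y) (hyz : y < z) (hx : 0 < g x)
    (hz : 0 < g z) : 0 < g y := by
  have := P.conc3 hxy hyz hx hz
  have h1 : 0 < (z - y) * g x := mul_pos (by linarith) hx
  have h2 : 0 < (y - x) * g z := mul_pos (by linarith) hz
  have h3 : 0 < (z - x) * g y := by linarith
  exact (mul_pos_iff_of_pos_left (by linarith)).1 h3

theorem g0_pos (P : Prof m g R) : 0 < g 0 := by
  obtain ⟨x, hx, hgx⟩ := P.ex_neg
  obtain ⟨y, hy, hgy⟩ := P.ex_pos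
  exact P.pos_mid hx hy hgx hgy

theorem support_line (P : Prof m g R) : ∃ μ, ∀ x, 0 < g x → g x ≤ g 0 + μ * x := by
  obtain ⟨x, hx, hgx⟩ := P.ex_neg
  obtain ⟨y, hy, hgy⟩ := P.ex_pos
  have sl : ∀ x y, x < 0 → 0 < y → 0 < g x → 0 < g y → (g y - g 0) / y ≤ (g 0 - g x) / (-x) := by
    intro x y hx hy hgx hgy
    have := P.conc3 hx hy hgx hgy
    rw [div_le_div_iff₀ hy (by linarith)]
    nlinarith
  set S := {t | ∃ y, 0 < y ∧ 0 < g y ∧ t = (g y - g 0) / y} with hS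
  refine ⟨sSup S, fun z hz => ?_⟩
  have hne : S.Nonempty := ⟨_, y, hy, hgy, rfl⟩
  rcases lt_trichotomy z 0 with h | h | h
  · have : sSup S ≤ (g 0 - g z) / (-z) := by
      apply csSup_le hne
      rintro t ⟨w, hw, hgw, rfl⟩
      exact sl z w h hw hz hgw
    rw [le_div_iff₀ (by linarith)] at this
    linarith
  · simp [h]
  · have hb : BddAbove S := by
      refine ⟨(g 0 - g x) / (-x), ?_⟩
      rintro t ⟨w, hw, hgw, rfl⟩
      exact sl x w hx hw hgx hgw
    have : (g z - g 0) / z ≤ sSup S := le_csSup hb ⟨z, h, hz, rfl⟩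
    rw [div_le_iff₀ h] at this
    linarith

theorem g0_bound (P : Prof m g R) : ((m : ℝ) + 1) / (m + 2) ≤ g 0 := by
  have hm0 : m ≠ 0 := by have := P.hm; omega
  obtain ⟨μ, hμ⟩ := P.support_line
  have h1 : ∫ x, g x ^ (m + 1) ≤ ∫ x, (g 0 * g x ^ m + μ * (x * g x ^ m)) := by
    apply integral_mono (P.intg_pow _ (by omega)) (((P.intg_pow m hm0).const_mul _).add
      ((P.intg_mul_pow m hm0).const_mul _))
    intro x
    simp only [Pi.add_apply]
    by_cases hx : g x = 0
    · simp [hx, hm0]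
    have := hμ x (lt_of_le_of_ne (P.nonneg x) (Ne.symm hx))
    have h2 := mul_le_mul_of_nonneg_right this (pow_nonneg (P.nonneg x) m)
    rw [pow_succ]
    nlinarith
  rw [integral_add ((P.intg_pow m hm0).const_mul _) ((P.intg_mul_pow m hm0).const_mul _),
    integral_const_mul, integral_const_mul, P.mass, P.bary] at h1
  have := P.J_bound
  rw [div_le_iff₀ (by positivity)]
  nlinarith

theorem f0_bound (P : Prof m g R) : 2 / ((m : ℝ) + 2) ≤ g 0 ^ m := by
  have h1 := pow_le_pow_left₀ (by positivity) P.g0_bound m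
  refine le_trans ?_ h1
  have h2 := one_add_mul_le_pow (a := -(1 / ((m : ℝ) + 2))) (by
    have : 1 / ((m : ℝ) + 2) ≤ 1 := by rw [div_le_one (by positivity)]; linarith [(Nat.cast_nonneg m : (0:ℝ) ≤ m)]
    linarith) m
  have e : 1 + -(1 / ((m : ℝ) + 2)) = (m + 1) / (m + 2) := by field_simp; ring
  rw [e] at h2
  refine le_trans (le_of_eq ?_) h2
  field_simp
  ring

end Prof

theorem cone_int (b u : ℝ) (m : ℕ) :
    ∫ x in u..b, (b - x) ^ m = (b - u) ^ (m + 1) / (m + 1) := by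
  rw [intervalIntegral.integral_comp_sub_left (fun y => y ^ m) b]
  simp

theorem Ld_final (N M L n d : ℝ) (hL : 0 < L) (hn : 0 < n) (hM : M = 1 + n / L) 
    (h : ∀ ρ, 0 < ρ → N ≤ 4 * ρ * M + L * d / ρ) : N ≤ 4 * √((L + n)) * √d := by
  have hM0 : 0 < M := by rw [hM]; positivity
  by_cases hd : d ≤ 0
  · rw [Real.sqrt_eq_zero_of_nonpos hd, mul_zero]
    by_contra! hN
    have := h (N / (8 * M)) (by positivity)
    have h2 : L * d / (N / (8 * M)) ≤ 0 := div_nonpos_of_nonpos_of_nonneg (by nlinarith) (by positivity)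
    have h3 : 4 * (N / (8 * M)) * M = N / 2 := by field_simp; norm_num
    linarith
  · push Not at hd
    have := h (√d * L / (2 * √(L + n))) (by positivity)
    refine this.trans (le_of_eq ?_)
    have e1 : √d ^ 2 = d := Real.sq_sqrt hd.le
    have e2 : √(L + n) ^ 2 = L + n := Real.sq_sqrt (by positivity)
    have e3 : M = √(L + n) ^ 2 / L := by rw [e2, hM]; field_simp
    rw [e3]
    have : 0 < √d := Real.sqrt_pos.2 hd
    have : 0 < √(L + n) := Real.sqrt_pos.2 (by positivity)
    field_simp
    nlinarith [e1]

/-- Abstract L1 bound from weighted moments. -/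
theorem abstract_L1 (h : ℝ → ℝ) (hmeas : Measurable h) (M R s t D : ℝ) (hM : ∀ x, |h x| ≤ M)
    (hR : ∀ x, R < |x| → h x = 0)
    (hs1 : ∀ x ≤ 0, 0 ≤ (x - s) * h x) (hs2 : ∀ x, 0 < x → 0 ≤ (x - t) * h x)
    (hi1 : ∫ x in Iic 0, h x = 0) (hi2 : ∫ x in Ioi 0, h x = 0) (hD : ∫ x, x * h x = D)
    (ρ : ℝ) (hρ : 0 < ρ) : ∫ x, |h x| ≤ 4 * ρ * M + D / ρ := by
  have hM0 : 0 ≤ M := (abs_nonneg _).trans (hM 0)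
  have hInt : Integrable h := intg hmeas M R hM hR
  have hxint : Integrable fun x => x * h x := by
    refine intg (measurable_id.mul hmeas) (|R| * M) R ?_ ?_
    · intro x
      rw [abs_mul]
      by_cases hx : R < |x|
      · rw [hR x hx]; simp; positivity
      · exact mul_le_mul ((not_lt.1 hx).trans (le_abs_self R)) (hM x) (abs_nonneg _) (abs_nonneg _)
    · intro x hx; simp [hR x hx]
  set w : ℝ → ℝ := fun x => x * h x - s * (Iic 0).indicator h x - t * (Ioi 0).indicator h x with hw
  have i1 : Integrable ((Iic (0:ℝ)).indicator h) := hInt.indicator measurableSet_Iic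
  have i2 : Integrable ((Ioi (0:ℝ)).indicator h) := hInt.indicator measurableSet_Ioi
  have hwint : Integrable w := (hxint.sub (i1.const_mul s)).sub (i2.const_mul t)
  have hsub : Integrable fun x => x * h x - s * (Iic 0).indicator h x := hxint.sub (i1.const_mul s)
  have hwD : ∫ x, w x = D := by
    simp only [hw]
    rw [integral_sub hsub (i2.const_mul t),
      integral_sub hxint (i1.const_mul s), integral_const_mul, integral_const_mul,
      integral_indicator measurableSet_Iic, integral_indicator measurableSet_Ioi, hi1, hi2, hD]
    ring
  set J1 : ℝ → ℝ := (Icc (s - ρ) (s + ρ)).indicator (fun _ => M) with hJ1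
  set J2 : ℝ → ℝ := (Icc (t - ρ) (t + ρ)).indicator (fun _ => M) with hJ2
  have j1 : Integrable J1 := (integrable_indicator_iff measurableSet_Icc).2 (by simp)
  have j2 : Integrable J2 := (integrable_indicator_iff measurableSet_Icc).2 (by simp)
  have j1' : ∫ x, J1 x = 2 * ρ * M := by
    rw [hJ1, integral_indicator measurableSet_Icc]
    simp only [integral_const, measureReal_restrict_apply MeasurableSet.univ, univ_inter,
      Real.volume_real_Icc, smul_eq_mul]
    rw [max_eq_left (by linarith)]; ring
  have j2' : ∫ x, J2 x = 2 * ρ * M := by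
    rw [hJ2, integral_indicator measurableSet_Icc]
    simp only [integral_const, measureReal_restrict_apply MeasurableSet.univ, univ_inter,
      Real.volume_real_Icc, smul_eq_mul]
    rw [max_eq_left (by linarith)]; ring
  have J1n : ∀ x, 0 ≤ J1 x := fun x => indicator_nonneg (fun _ _ => hM0) x
  have J2n : ∀ x, 0 ≤ J2 x := fun x => indicator_nonneg (fun _ _ => hM0) x
  have gen : ∀ (x r : ℝ), 0 ≤ (x - r) * h x →
      |h x| ≤ (Icc (r - ρ) (r + ρ)).indicator (fun _ => M) x + (x - r) * h x / ρ := by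
    intro x r hr
    by_cases hx : x ∈ Icc (r - ρ) (r + ρ)
    · rw [indicator_of_mem hx]
      have := hM x
      have : 0 ≤ (x - r) * h x / ρ := by positivity
      linarith
    · rw [indicator_of_notMem hx, zero_add, le_div_iff₀ hρ, ← abs_of_nonneg hr, abs_mul, mul_comm]
      have : ρ ≤ |x - r| := by
        by_contra! hlt
        rw [abs_lt] at hlt
        exact hx ⟨by linarith, by linarith⟩
      gcongr
  have hpt : ∀ x, |h x| ≤ J1 x + J2 x + w x / ρ := by
    intro x
    rcases le_or_gt x 0 with hx | hx
    · have h1 := gen x s (hs1 x hx)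
      have : w x = (x - s) * h x := by
        simp only [hw]
        rw [indicator_of_mem (show x ∈ Iic (0:ℝ) from hx), indicator_of_notMem (by simpa using hx)]
        ring
      rw [this]
      have := J2n x
      linarith
    · have h1 := gen x t (hs2 x hx)
      have : w x = (x - t) * h x := by
        simp only [hw]
        rw [indicator_of_mem (show x ∈ Ioi (0:ℝ) from hx), indicator_of_notMem (by simpa using hx)]
        ring
      rw [this]
      have := J1n x
      linarith
  have := integral_mono hInt.abs ((j1.add j2).add (hwint.div_const ρ)) hpt
  simp only [Pi.add_apply] at this
  have j12 : Integrable fun x => J1 x + J2 x := j1.add j2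
  rw [integral_add j12 (hwint.div_const ρ), integral_add j1 j2, integral_div, j1', j2', hwD] at this
  linarith

namespace Prof
variable {m : ℕ} {g : ℝ → ℝ} {R : ℝ}

theorem V_pos (P : Prof m g R) : 0 < ∫ x in Ioi 0, g x ^ m := by
  have hm0 : m ≠ 0 := by have := P.hm; omega
  obtain ⟨y, hy, hgy⟩ := P.ex_pos
  rw [setIntegral_pos_iff_support_of_nonneg_ae
    (Filter.Eventually.of_forall fun x => pow_nonneg (P.nonneg x) m)
    (P.intg_pow m hm0).integrableOn]
  have : Ioo 0 y ⊆ Function.support (fun x => g x ^ m) ∩ Ioi 0 := by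
    intro x hx
    exact ⟨(pow_pos (P.pos_mid hx.1 hx.2 P.g0_pos hgy) m).ne', hx.1⟩
  refine lt_of_lt_of_le ?_ (measure_mono this)
  simp [hy]

theorem V_le (P : Prof m g R) : ∫ x in Ioi 0, g x ^ m ≤ 1 := by
  have hm0 : m ≠ 0 := by have := P.hm; omega
  rw [← P.mass]
  exact setIntegral_le_integral (P.intg_pow m hm0) 
    (Filter.Eventually.of_forall fun x => pow_nonneg (P.nonneg x) m)

theorem main (P : Prof m g R) (V b L d : ℝ) (hV : V = ∫ x in Ioi 0, g x ^ m)
    (hb : b = (m + 1) / g 0 ^ m * V) (hL : 0 < L) (hLn : L ^ (m + 1) = (m + 1) * b ^ m / g 0 ^ m)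
    (hd : L * d = b - (m + 1) / (m + 2) * L) (c : ℝ → ℝ)
    (hc : ∀ x, c x = if x ∈ Icc (b - L) b then g 0 * (b - x) / b else 0) :
    ∫ x, |c x ^ m - g x ^ m| ≤ 4 * √(L + (m + 1)) * √d ∧ L ≤ (m + 1) * (m + 2) / 2 := by
  have hm0 : m ≠ 0 := by have := P.hm; omega
  have hV0 : 0 < V := hV ▸ P.V_pos
  have hV1 : V ≤ 1 := hV ▸ P.V_le
  have hg0 := P.g0_pos
  have hf0 : 0 < g 0 ^ m := pow_pos hg0 m
  have hb0 : 0 < b := by rw [hb]; positivity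
  have hbm : 0 < b ^ m := pow_pos hb0 m
  have hbn : b ^ (m + 1) = V * L ^ (m + 1) := by
    rw [hLn, pow_succ]
    nth_rewrite 2 [hb]
    field_simp
  have hbL : b ≤ L := by
    refine le_of_pow_le_pow_left₀ (n := m + 1) (by omega) hL.le ?_
    rw [hbn]
    have := pow_pos hL (m + 1)
    nlinarith
  set κ := g 0 ^ m / b ^ m with hκ
  have hκ0 : 0 < κ := by positivity
  have hκL : κ * L ^ (m + 1) = m + 1 := by
    rw [hLn, hκ]; field_simp
  have hLb : L ≤ (m + 1) * (m + 2) / 2 := by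
    have h1 : g 0 ^ m * L ≤ m + 1 := by
      rw [← hκL, hκ, pow_succ, div_mul_eq_mul_div, le_div_iff₀ hbm]
      have : b ^ m ≤ L ^ m := pow_le_pow_left₀ hb0.le hbL m
      have : 0 < g 0 ^ m * L := by positivity
      nlinarith
    have h2 := P.f0_bound
    rw [div_le_iff₀ (by positivity)] at h2
    rw [le_div_iff₀ (by norm_num)]
    nlinarith
  refine ⟨?_, hLb⟩
  -- the cone density
  set C : ℝ → ℝ := fun x => c x ^ m with hC
  have hCi : C = (Icc (b - L) b).indicator (fun x => κ * (b - x) ^ m) := by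
    ext x
    simp only [hC, hc, indicator]
    split_ifs
    · rw [div_pow, mul_pow, hκ]; ring
    · simp [hm0]
  have hCmeas : Measurable C := by
    rw [hCi]
    exact Measurable.indicator (by fun_prop) measurableSet_Icc
  have hC0 : ∀ x, 0 ≤ C x := by
    intro x
    rw [hCi]
    refine indicator_nonneg (fun y hy => ?_) x
    have : 0 ≤ b - y := by linarith [hy.2]
    positivity
  have hC1 : ∀ x, C x ≤ (m + 1) / L := by
    intro x
    have h0 : (0:ℝ) ≤ (m + 1) / L := by positivity
    rw [hCi]
    refine indicator_le' (fun y hy => ?_) (fun y _ => h0) x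
    rw [← hκL, pow_succ, le_div_iff₀ hL]
    have : (b - y) ^ m ≤ L ^ m := pow_le_pow_left₀ (by linarith [hy.2]) (by linarith [hy.1]) m
    have := mul_le_mul_of_nonneg_left this (mul_pos hκ0 hL).le
    nlinarith
  have hCs : ∀ x, L < |x| → C x = 0 := by
    intro x hx
    rw [hCi, indicator_of_notMem]
    rintro ⟨h1, h2⟩
    have : |x| ≤ L := abs_le.2 ⟨by linarith, by linarith⟩
    linarith
  have hCint : Integrable C := by
    refine intg hCmeas ((m + 1) / L) L (fun x => ?_) hCs
    rw [abs_of_nonneg (hC0 x)]; exact hC1 x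
  have hCxint : Integrable fun x => x * C x := by
    refine intg (measurable_id.mul hCmeas) (L * ((m + 1) / L)) L (fun x => ?_) (fun x hx => by simp [hCs x hx])
    rw [abs_mul, abs_of_nonneg (hC0 x)]
    by_cases hx : L < |x|
    · rw [hCs x hx]; simp; positivity
    · exact mul_le_mul (not_lt.1 hx) (hC1 x) (hC0 x) hL.le
  have hbLb : b - L ≤ b := by linarith
  have c1 : ∫ x, C x = 1 := by
    rw [hCi, integral_indicator measurableSet_Icc, integral_Icc_eq_integral_Ioc,
      ← intervalIntegral.integral_of_le hbLb, intervalIntegral.integral_const_mul, cone_int,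
      sub_sub_cancel, mul_div_assoc', hκL, div_self (by positivity)]
  have c2 : ∫ x in Ioi 0, C x = V := by
    have e : Ioi 0 ∩ Icc (b - L) b = Ioc 0 b := by
      ext x
      simp only [mem_inter_iff, mem_Ioi, mem_Icc, mem_Ioc]
      constructor
      · rintro ⟨h1, h2, h3⟩; exact ⟨h1, h3⟩
      · rintro ⟨h1, h2⟩; exact ⟨h1, by linarith, h2⟩
    rw [hCi, setIntegral_indicator measurableSet_Icc, e, ← intervalIntegral.integral_of_le hb0.le,
      intervalIntegral.integral_const_mul, cone_int, sub_zero, hbn, mul_div_assoc', mul_left_comm, hκL]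
    field_simp
  have c3 : ∫ x, x * C x = L * d := by
    have e : (fun x => x * C x) = (Icc (b - L) b).indicator
        (fun x => κ * (b * (b - x) ^ m - (b - x) ^ (m + 1))) := by
      ext x
      rw [hCi]
      simp only [indicator]
      split_ifs
      · ring
      · simp
    rw [e, integral_indicator measurableSet_Icc, integral_Icc_eq_integral_Ioc,
      ← intervalIntegral.integral_of_le hbLb, intervalIntegral.integral_const_mul,
      intervalIntegral.integral_sub (Continuous.intervalIntegrable (by fun_prop) _ _)
        (Continuous.intervalIntegrable (by fun_prop) _ _),
      intervalIntegral.integral_const_mul, cone_int, cone_int, sub_sub_cancel, hd]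
    have : κ * (b * (L ^ (m + 1) / (m + 1)) - L ^ (m + 1 + 1) / (((m + 1 : ℕ) : ℝ) + 1)) =
        (κ * L ^ (m + 1)) * (b / (m + 1) - L / (m + 2)) := by
      push_cast
      rw [pow_succ L (m + 1)]
      field_simp
      ring
    rw [this, hκL]
    field_simp
  -- the linear function
  set ℓ : ℝ → ℝ := fun x => g 0 * (b - x) / b with hℓ
  have lin : ∀ x y, y * ℓ x = (y - x) * g 0 + x * ℓ y := by
    intro x y; simp only [hℓ]; field_simp; ring
  have cpos : ∀ x, 0 < x → x ≤ b → c x = ℓ x := by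
    intro x hx hxb
    rw [hc, if_pos ⟨by linarith, hxb⟩]
  have cge : ∀ x, 0 < x → ℓ x ≤ c x ∧ 0 ≤ c x := by
    intro x hx
    by_cases hxb : x ≤ b
    · rw [cpos x hx hxb]
      refine ⟨le_rfl, ?_⟩
      have : 0 ≤ b - x := by linarith
      simp only [hℓ]; positivity
    · rw [hc, if_neg (fun h => hxb h.2)]
      refine ⟨?_, le_rfl⟩
      simp only [hℓ]
      apply div_nonpos_of_nonpos_of_nonneg _ hb0.le
      nlinarith
  -- left comparison
  have left : ∀ x, x < 0 → g x ≤ ℓ x := by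
    intro x hx
    by_contra! hlt
    have hℓx : 0 < ℓ x := by
      have : 0 < b - x := by linarith
      simp only [hℓ]; positivity
    have hgx : 0 < g x := hℓx.trans hlt
    have strict : ∀ y, 0 < y → 0 < g y → g y < ℓ y := by
      intro y hy hgy
      have h1 := P.conc3 hx hy hgx hgy
      have h2 := lin x y
      have h3 : y * ℓ x < y * g x := mul_lt_mul_of_pos_left hlt hy
      have h4 : (-x) * g y < (-x) * ℓ y := by nlinarith
      exact lt_of_mul_lt_mul_left h4 (by linarith)
    have st2 : ∀ y, 0 < y → y < b → g y < c y := by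
      intro y hy hyb
      rw [cpos y hy hyb.le]
      by_cases h : 0 < g y
      · exact strict y hy h
      · have : 0 < b - y := by linarith
        have : 0 < ℓ y := by simp only [hℓ]; positivity
        linarith
    have le2 : ∀ y, 0 < y → g y ≤ c y := by
      intro y hy
      by_cases h : 0 < g y
      · exact (strict y hy h).le.trans (cge y hy).1
      · exact (not_lt.1 h).trans (cge y hy).2
    have hsub : Integrable (fun y => C y - g y ^ m) := hCint.sub (P.intg_pow m hm0)
    have hpos : 0 < ∫ y in Ioi 0, (C y - g y ^ m) := by
      rw [setIntegral_pos_iff_support_of_nonneg_ae _ hsub.integrableOn]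
      · have : Ioo 0 b ⊆ Function.support (fun y => C y - g y ^ m) ∩ Ioi 0 := by
          intro y hy
          refine ⟨?_, hy.1⟩
          have := pow_lt_pow_left₀ (st2 y hy.1 hy.2) (P.nonneg y) hm0
          simp only [Function.mem_support, hC]
          linarith
        refine lt_of_lt_of_le ?_ (measure_mono this)
        simp [hb0]
      · rw [Filter.EventuallyLE, ae_restrict_iff' measurableSet_Ioi]
        refine Filter.Eventually.of_forall fun y hy => ?_
        have := pow_le_pow_left₀ (P.nonneg y) (le2 y hy) m
        simpa [hC] using this
    rw [integral_sub hCint.integrableOn (P.intg_pow m hm0).integrableOn, c2, ← hV] at hpos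
    simp at hpos
  -- right crossing
  have cross : ∀ x y, 0 < x → x < y → g x < c x → g y ≤ c y := by
    intro x y hx hxy hlt
    by_cases hgy : 0 < g y
    · have hxb : x ≤ b := by
        by_contra h
        rw [hc, if_neg (fun h' => h h'.2)] at hlt
        exact absurd hlt (not_lt.2 (P.nonneg x))
      rw [cpos x hx hxb] at hlt
      have h1 := P.conc3 hx hxy hg0 hgy
      have h2 := lin x y
      have h3 : y * g x < y * ℓ x := mul_lt_mul_of_pos_left hlt (hx.trans hxy)
      have h4 : x * g y < x * ℓ y := by nlinarith
      exact (lt_of_mul_lt_mul_left h4 hx.le).le.trans (cge y (hx.trans hxy)).1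
    · exact (not_lt.1 hgy).trans (cge y (hx.trans hxy)).2
  obtain ⟨s, hs1, hs2⟩ : ∃ s, (∀ x, 0 < x → x < s → c x ≤ g x) ∧ (∀ x, 0 < x → s < x → g x ≤ c x) := by
    set T := {x | 0 < x ∧ g x < c x} ∪ Ioi (|R| + b) with hT
    have hTn : T.Nonempty := ⟨|R| + b + 1, Or.inr (by simp)⟩
    have hTb : BddBelow T := by
      refine ⟨0, ?_⟩
      rintro x (hx | hx)
      · exact hx.1.le
      · have := abs_nonneg R
        have hx' : |R| + b < x := hx
        linarith
    refine ⟨sInf T, ?_, ?_⟩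
    · intro x hx hxs
      by_contra! h
      exact absurd (csInf_le hTb (Or.inl ⟨hx, h⟩)) (not_le.2 hxs)
    · intro x hx hxs
      obtain ⟨y, hy, hyx⟩ := exists_lt_of_csInf_lt hTn hxs
      rcases hy with hy | hy
      · exact cross y x hy.1 hyx hy.2
      · have hy' : |R| + b < y := hy
        have : g x = 0 := P.supp x (by
          have := le_abs_self x
          have := le_abs_self R
          linarith)
        rw [this]
        exact (cge x hx).2
  -- apply the abstract bound
  have hmass : ∫ x, (C x - g x ^ m) = 0 := by
    rw [integral_sub hCint (P.intg_pow m hm0), c1, P.mass, sub_self]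
  have hright : ∫ x in Ioi 0, (C x - g x ^ m) = 0 := by
    rw [integral_sub hCint.integrableOn (P.intg_pow m hm0).integrableOn, c2, ← hV, sub_self]
  have hleft : ∫ x in Iic 0, (C x - g x ^ m) = 0 := by
    have := intervalIntegral.integral_Iic_add_Ioi (b := (0:ℝ)) (f := fun x => C x - g x ^ m)
      (hCint.sub (P.intg_pow m hm0)).integrableOn (hCint.sub (P.intg_pow m hm0)).integrableOn
    rw [hright, hmass, add_zero] at this
    exact this
  refine Ld_final _ (1 + (m + 1) / L) L (m + 1) d hL (by positivity) rfl fun ρ hρ => ?_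
  refine abstract_L1 (fun x => C x - g x ^ m) (hCmeas.sub (P.meas.pow_const m)) (1 + (m + 1) / L)
    (max R L) (b - L) s (L * d) ?_ ?_ ?_ ?_ hleft hright ?_ ρ hρ
  · intro x
    have h1 := hC0 x
    have h2 := hC1 x
    have h3 := pow_nonneg (P.nonneg x) m
    have h4 := pow_le_one₀ (n := m) (P.nonneg x) (P.le_one x)
    rw [abs_le]
    constructor <;> linarith
  · intro x hx
    simp [hCs x ((le_max_right _ _).trans_lt hx), P.supp x ((le_max_left _ _).trans_lt hx), hm0]
  · intro x hx
    by_cases hxa : x < b - L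
    · have : C x = 0 := by
        rw [hCi, indicator_of_notMem]
        intro h; linarith [h.1]
      rw [this]
      have := pow_nonneg (P.nonneg x) m
      nlinarith
    · have hxa := not_lt.1 hxa
      have hcx : c x = ℓ x := by rw [hc, if_pos ⟨hxa, by linarith⟩]
      have hgc : g x ≤ c x := by
        rcases hx.lt_or_eq with h | h
        · rw [hcx]; exact left x h
        · rw [hcx, h]; simp only [hℓ]; apply le_of_eq; field_simp; ring
      have := pow_le_pow_left₀ (P.nonneg x) hgc m
      exact mul_nonneg (by linarith) (by simp only [hC]; linarith)
  · intro x hx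
    rcases lt_trichotomy x s with h | h | h
    · have := pow_le_pow_left₀ (cge x hx).2 (hs1 x hx h) m
      exact mul_nonneg_of_nonpos_of_nonpos (by linarith) (by simp only [hC]; linarith)
    · simp [h]
    · have := pow_le_pow_left₀ (P.nonneg x) (hs2 x hx h) m
      exact mul_nonneg (by linarith) (by simp only [hC]; linarith)
  · simp only [mul_sub]
    rw [integral_sub hCxint (P.intg_mul_pow m hm0), P.bary, c3, sub_zero]

end Prof

theorem aux_main (m : ℕ) (hm : 1 ≤ m)
    (K : Set (ℝ × EuclideanSpace ℝ (Fin m)))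
    (hKcomp : IsCompact K) (hKconv : Convex ℝ K)
    (hH1 : (∫ p in K, p) = 0)
    (hH3le : ∀ x : ℝ, volume {y : EuclideanSpace ℝ (Fin m) | (x, y) ∈ K} ≤ 1)
    (hH3eq : ∃ x : ℝ, volume {y : EuclideanSpace ℝ (Fin m) | (x, y) ∈ K} = 1)
    (hH4 : volume K = 1)
    (g : ℝ → ℝ)
    (hg : ∀ x, g x = (volume {y : EuclideanSpace ℝ (Fin m) | (x, y) ∈ K}).toReal
              ^ ((((m + 1 : ℕ) : ℝ) - 1)⁻¹))
    (a' b' : ℝ)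
    (hb' : b' = (((m + 1 : ℕ) : ℝ) / (volume {y : EuclideanSpace ℝ (Fin m) | ((0:ℝ), y) ∈ K}).toReal)
            * (volume (K ∩ {p : ℝ × EuclideanSpace ℝ (Fin m) | 0 ≤ p.1})).toReal)
    (ha' : a' = b' - ((((m + 1 : ℕ) : ℝ) * b' ^ m)
            / (volume {y : EuclideanSpace ℝ (Fin m) | ((0:ℝ), y) ∈ K}).toReal)
              ^ (((m + 1 : ℕ) : ℝ)⁻¹))
    (d : ℝ)
    (hd : d = (volume (K ∩ {p : ℝ × EuclideanSpace ℝ (Fin m) | 0 ≤ p.1})).toReal ^ (((m + 1 : ℕ) : ℝ)⁻¹)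
            - ((((m + 1 : ℕ) : ℝ) / (((m + 1 : ℕ) : ℝ) + 1)) ^ (m + 1)) ^ (((m + 1 : ℕ) : ℝ)⁻¹))
    (c : ℝ → ℝ)
    (hc : ∀ x, c x = if x ∈ Icc a' b' then g 0 * (b' - x) / b' else 0) :
    (∫ x, |c x ^ m - g x ^ m|) ≤ 16 * ((m + 1 : ℕ) : ℝ) ^ ((3:ℝ)/2) * Real.sqrt d := by
  have hm0 : m ≠ 0 := by omega
  have hKm : MeasurableSet K := hKcomp.measurableSet
  set v : ℝ → ℝ≥0∞ := fun x => volume {y : EuclideanSpace ℝ (Fin m) | (x, y) ∈ K} with hv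
  have hvm : Measurable v := measurable_measure_prodMk_left hKm
  have hvt : ∀ x, v x ≠ ⊤ := fun x => ne_top_of_le_ne_top ENNReal.one_ne_top (hH3le x)
  have hexp : ((((m + 1 : ℕ) : ℝ) - 1)⁻¹) = (m : ℝ)⁻¹ := by push_cast; ring_nf
  have hg' : ∀ x, g x = (v x).toReal ^ ((m : ℝ)⁻¹) := by
    intro x; rw [hg, hexp]
  have hgm : ∀ x, g x ^ m = (v x).toReal := by
    intro x
    rw [hg', Real.rpow_inv_natCast_pow ENNReal.toReal_nonneg hm0]
  have hgn : ∀ x, 0 ≤ g x := fun x => by rw [hg']; exact Real.rpow_nonneg ENNReal.toReal_nonneg _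
  have hvg : ∀ x, v x = ENNReal.ofReal (g x ^ m) := by
    intro x; rw [hgm, ENNReal.ofReal_toReal (hvt x)]
  obtain ⟨R, hR⟩ := hKcomp.isBounded.subset_closedBall 0
  have hsecm : ∀ x : ℝ, MeasurableSet {y : EuclideanSpace ℝ (Fin m) | (x, y) ∈ K} := fun x =>
    measurable_prodMk_left hKm
  have P : Prof m g R := by
    refine ⟨hm, ?_, hgn, ?_, ?_, ?_, ?_, ?_, ?_⟩
    · have : g = fun x => (v x).toReal ^ ((m : ℝ)⁻¹) := funext hg'
      rw [this]
      exact hvm.ennreal_toReal.pow_const _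
    · intro x
      rw [hg']
      refine Real.rpow_le_one ENNReal.toReal_nonneg ?_ (by positivity)
      exact ENNReal.toReal_le_of_le_ofReal zero_le_one (by simpa using hH3le x)
    · obtain ⟨x, hx⟩ := hH3eq
      refine ⟨x, ?_⟩
      have hx' : v x = 1 := hx
      rw [hg', hx']; simp
    · intro x hx
      have : v x = 0 := by
        have e : {y : EuclideanSpace ℝ (Fin m) | (x, y) ∈ K} = ∅ := by
          rw [eq_empty_iff_forall_notMem]
          intro y hy
          have h1 := hR hy
          rw [mem_closedBall_zero_iff] at h1
          have h2 := norm_fst_le (x, y)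
          simp only [Real.norm_eq_abs] at h2
          linarith
        simp only [hv, e, measure_empty]
      rw [hg', this]
      simp [hm0]
    · intro x y hx hy p q hp hq hpq
      have := BM m _ _ {z : EuclideanSpace ℝ (Fin m) | (p * x + q * y, z) ∈ K} (hsecm x) (hsecm y)
        (hsecm _) (g x) (g y) hx hy (hvg x) (hvg y) hp hq (by
          intro u hu w hw
          have := hKconv hu hw hp.le hq.le hpq
          simpa using this)
      have h2 : ENNReal.ofReal ((p * g x + q * g y) ^ m) ≤ ENNReal.ofReal (g (p * x + q * y) ^ m) := by
        rw [← hvg]; exact this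
      rw [ENNReal.ofReal_le_ofReal_iff (pow_nonneg (hgn _) _)] at h2
      exact le_of_pow_le_pow_left₀ hm0 (hgn _) h2
    · simp only [hgm]
      rw [integral_toReal hvm.aemeasurable (Filter.Eventually.of_forall fun x => (hvt x).lt_top)]
      have : volume K = ∫⁻ x, v x := by
        rw [Measure.volume_eq_prod, Measure.prod_apply hKm]; rfl
      rw [← this, hH4]; simp
    · have hid : IntegrableOn (fun p : ℝ × EuclideanSpace ℝ (Fin m) => p) K :=
        continuousOn_id.integrableOn_compact hKcomp
      have h1 : ∫ p in K, p.1 = 0 := by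
        have := (ContinuousLinearMap.fst ℝ ℝ (EuclideanSpace ℝ (Fin m))).integral_comp_comm hid
        simp only [ContinuousLinearMap.coe_fst'] at this
        rw [this, hH1]; rfl
      have hfst : IntegrableOn (fun p : ℝ × EuclideanSpace ℝ (Fin m) => p.1) K :=
        continuous_fst.continuousOn.integrableOn_compact hKcomp
      rw [← integral_indicator hKm, Measure.volume_eq_prod, integral_prod _
        (by rw [← Measure.volume_eq_prod]; exact (integrable_indicator_iff hKm).2 hfst)] at h1
      rw [← h1]
      congr 1
      ext x
      have : (fun y : EuclideanSpace ℝ (Fin m) => K.indicator (fun p => p.1) (x, y)) =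
          {y : EuclideanSpace ℝ (Fin m) | (x, y) ∈ K}.indicator (fun _ => x) := by
        ext y
        by_cases h : (x, y) ∈ K <;> simp [indicator, h]
      rw [this, integral_indicator (hsecm x), integral_const, hgm, smul_eq_mul, mul_comm]
      simp [Measure.real, hv]
  have hVeq : (volume (K ∩ {p : ℝ × EuclideanSpace ℝ (Fin m) | 0 ≤ p.1})).toReal =
      ∫ x in Ioi 0, g x ^ m := by
    simp only [hgm]
    rw [integral_toReal hvm.aemeasurable (Filter.Eventually.of_forall fun x => (hvt x).lt_top)]
    congr 1
    have hmm : MeasurableSet {p : ℝ × EuclideanSpace ℝ (Fin m) | 0 ≤ p.1} :=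
      measurableSet_le measurable_const measurable_fst
    rw [Measure.volume_eq_prod, Measure.prod_apply (hKm.inter hmm),
      setLIntegral_congr Ioi_ae_eq_Ici, ← lintegral_indicator measurableSet_Ici]
    congr 1
    ext x
    by_cases hx : 0 ≤ x
    · rw [indicator_of_mem (show x ∈ Ici (0:ℝ) from hx)]
      simp only [hv]
      congr 1
      ext y
      simp [hx]
    · rw [indicator_of_notMem (by simpa using hx)]
      have : Prod.mk x ⁻¹' (K ∩ {p : ℝ × EuclideanSpace ℝ (Fin m) | 0 ≤ p.1}) = ∅ := by
        ext y
        simp [hx]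
      rw [this, measure_empty]
  set V := (volume (K ∩ {p : ℝ × EuclideanSpace ℝ (Fin m) | 0 ≤ p.1})).toReal with hVdef
  have h0 : (volume {y : EuclideanSpace ℝ (Fin m) | ((0:ℝ), y) ∈ K}).toReal = g 0 ^ m :=
    (hgm 0).symm
  rw [h0] at hb' ha'
  have hV0 : 0 < V := hVeq ▸ P.V_pos
  have hf0 : 0 < g 0 ^ m := pow_pos P.g0_pos m
  have hb0 : 0 < b' := by rw [hb']; positivity
  set L := ((((m + 1 : ℕ) : ℝ) * b' ^ m) / g 0 ^ m) ^ (((m + 1 : ℕ) : ℝ)⁻¹) with hL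
  have hL0 : 0 < L := by rw [hL]; positivity
  have hLn : L ^ (m + 1) = ((m + 1 : ℕ) : ℝ) * b' ^ m / g 0 ^ m :=
    Real.rpow_inv_natCast_pow (by positivity) (by omega)
  have hbn : V = (b' / L) ^ (m + 1) := by
    rw [div_pow, hLn, pow_succ]
    nth_rewrite 2 [hb']
    field_simp
  have hdd : L * d = b' - (m + 1) / (m + 2) * L := by
    rw [hd, hbn, Real.pow_rpow_inv_natCast (by positivity) (by omega),
      Real.pow_rpow_inv_natCast (by positivity) (by omega)]
    push_cast
    field_simp
    ring
  obtain ⟨r1, r2⟩ := P.main V b' L d hVeq (by rw [hb']; push_cast; ring) hL0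
    (by rw [hLn]; push_cast; ring) hdd c (by rw [← ha']; exact hc)
  refine r1.trans ?_
  have hm1 : (1:ℝ) ≤ m := by exact_mod_cast hm
  have h32 : ((m + 1 : ℕ) : ℝ) ^ ((3:ℝ)/2) = √(((m:ℝ) + 1) ^ 3) := by
    rw [Real.sqrt_eq_rpow, ← Real.rpow_natCast, ← Real.rpow_mul (by positivity)]
    push_cast; norm_num
  rw [h32]
  have : √(L + (m + 1)) ≤ √((4:ℝ) ^ 2 * ((m:ℝ) + 1) ^ 3) := by
    apply Real.sqrt_le_sqrt
    nlinarith [sq_nonneg (m:ℝ), pow_pos (show (0:ℝ) < m by linarith) 3]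
  rw [Real.sqrt_mul (by positivity), Real.sqrt_sq (by norm_num)] at this
  have h5 := mul_le_mul_of_nonneg_right this (Real.sqrt_nonneg d)
  nlinarith

theorem integral_abs_h_bound (n : ℕ) (hn : 2 ≤ n)
    (K : Set (ℝ × EuclideanSpace ℝ (Fin (n - 1))))
    (hKcomp : IsCompact K) (hKconv : Convex ℝ K)
    -- (H1): the centroid of K is the origin
    (hH1 : (∫ p in K, p) = 0)
    -- (H3): max_x |K_x| = 1
    (hH3le : ∀ x : ℝ, volume {y : EuclideanSpace ℝ (Fin (n - 1)) | (x, y) ∈ K} ≤ 1)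
    (hH3eq : ∃ x : ℝ, volume {y : EuclideanSpace ℝ (Fin (n - 1)) | (x, y) ∈ K} = 1)
    -- (H4): |K| = 1
    (hH4 : volume K = 1)
    (a b : ℝ)
    (ha : IsLeast (Prod.fst '' K) a) (hb : IsGreatest (Prod.fst '' K) b)
    (g : ℝ → ℝ)
    (hg : ∀ x, g x = (volume {y : EuclideanSpace ℝ (Fin (n - 1)) | (x, y) ∈ K}).toReal
              ^ (((n:ℝ) - 1)⁻¹))
    (a' b' : ℝ)
    (hb' : b' = ((n:ℝ) / (volume {y : EuclideanSpace ℝ (Fin (n - 1)) | ((0:ℝ), y) ∈ K}).toReal)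
            * (volume (K ∩ {p : ℝ × EuclideanSpace ℝ (Fin (n - 1)) | 0 ≤ p.1})).toReal)
    (ha' : a' = b' - (((n:ℝ) * b' ^ (n - 1))
            / (volume {y : EuclideanSpace ℝ (Fin (n - 1)) | ((0:ℝ), y) ∈ K}).toReal)
              ^ ((n:ℝ)⁻¹))
    (d : ℝ)
    (hd : d = (volume (K ∩ {p : ℝ × EuclideanSpace ℝ (Fin (n - 1)) | 0 ≤ p.1})).toReal ^ ((n:ℝ)⁻¹)
            - (((n:ℝ) / (n + 1)) ^ n) ^ ((n:ℝ)⁻¹))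
    (c : ℝ → ℝ)
    (hc : ∀ x, c x = if x ∈ Icc a' b' then g 0 * (b' - x) / b' else 0) :
    (∫ x, |c x ^ (n - 1) - g x ^ (n - 1)|) ≤ 16 * (n:ℝ) ^ ((3:ℝ)/2) * Real.sqrt d := by
  obtain ⟨m, rfl⟩ : ∃ m, n = m + 1 := ⟨n - 1, by omega⟩
  exact aux_main m (by omega) K hKcomp hKconv hH1 hH3le hH3eq hH4 g hg a' b' hb' ha' d hd c hc
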